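/- Let α, β, γ > 0 be real. Then for every x ≥ 0, the (unnormalized) second moment series of the Prabhakar-type distribution satisfies ∑_{k=0}^∞ k² (γ)_k x^k / (k! Γ(αk+β)) = γ x E_{α, α+β}^{γ+1}(x) + γ(γ+1) x² E_{α, 2α+β}^{γ+2}(x). -/

import Mathlib

open scoped BigOperators

/-- Pochhammer symbol `(γ)_k = Γ(γ+k)/Γ(γ)`. -/
noncomputable def poch (γ : ℝ) (k : ℕ) : ℝ := Real.Gamma (γ + k) / Real.Gamma γ

/-- The Prabhakar (three-parameter Mittag-Leffler) function
`E_{α,β}^γ(x) = ∑_{k≥0} (γ)_k x^k / (k! Γ(αk+β))`. -/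
noncomputable def prabhakar (α β γ x : ℝ) : ℝ :=
  ∑' k : ℕ, poch γ k * x ^ k / (k.factorial * Real.Gamma (α * k + β))

/-- Log-convexity bound for the growth of `Γ` under a real shift. -/
lemma sub_one_rpow_mul_Gamma_le_Gamma_add {s a : ℝ} (hs : 1 < s) (ha : 0 < a) :
    (s - 1) ^ a * Real.Gamma s ≤ Real.Gamma (s + a) := by
  have hs0 : 0 < s - 1 := by linarith
  have hΓ : 0 < Real.Gamma (s - 1) := Real.Gamma_pos_of_pos hs0
  have hΓs : 0 < Real.Gamma s := Real.Gamma_pos_of_pos (by linarith)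
  have hΓa : 0 < Real.Gamma (s + a) := Real.Gamma_pos_of_pos (by linarith)
  have hslope := Real.convexOn_log_Gamma.slope_mono_adjacent (x := s - 1) (y := s) (z := s + a)
    hs0 (Set.mem_Ioi.2 (by linarith)) (by linarith) (by linarith)
  have hrec : Real.Gamma s = (s - 1) * Real.Gamma (s - 1) := by
    rw [← Real.Gamma_add_one hs0.ne', sub_add_cancel]
  have hlog : Real.log (Real.Gamma s) - Real.log (Real.Gamma (s - 1)) = Real.log (s - 1) := by
    rw [hrec, Real.log_mul hs0.ne' hΓ.ne', add_sub_cancel_right]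
  simp only [Function.comp_apply, sub_sub_cancel, div_one, add_sub_cancel_left] at hslope
  rw [hlog, le_div_iff₀ ha] at hslope
  rw [← Real.log_le_log_iff (by positivity) hΓa,
    Real.log_mul (by positivity) hΓs.ne', Real.log_rpow hs0]
  linarith

lemma poch_pos {γ : ℝ} (hγ : 0 < γ) (k : ℕ) : 0 < poch γ k :=
  div_pos (Real.Gamma_pos_of_pos (by positivity)) (Real.Gamma_pos_of_pos hγ)

lemma poch_succ {γ : ℝ} (hγ : 0 < γ) (k : ℕ) : poch γ (k + 1) = (γ + k) * poch γ k := by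
  have h : γ + k ≠ 0 := by positivity
  rw [poch, poch, Nat.cast_succ, ← add_assoc, Real.Gamma_add_one h, mul_div_assoc]

lemma poch_succ_left {γ : ℝ} (hγ : 0 < γ) (k : ℕ) : poch γ (k + 1) = γ * poch (γ + 1) k := by
  have h := (Real.Gamma_pos_of_pos hγ).ne'
  rw [poch, poch, Real.Gamma_add_one hγ.ne', Nat.cast_succ,
    show γ + ((k : ℝ) + 1) = γ + 1 + k by ring]
  field_simp

/-- The series defining the Prabhakar function converges for every real argument. -/
lemma summable_prabhakar {α β γ : ℝ} (hα : 0 < α) (hβ : 0 < β) (hγ : 0 < γ) (x : ℝ) :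
    Summable fun k : ℕ => poch γ k * x ^ k / (k.factorial * Real.Gamma (α * k + β)) := by
  have hlin : Filter.Tendsto (fun k : ℕ => α * (k : ℝ) + β - 1) Filter.atTop Filter.atTop := by
    simp only [add_sub_assoc]
    exact Filter.tendsto_atTop_add_const_right _ _
      (tendsto_natCast_atTop_atTop.const_mul_atTop hα)
  have hpow := (tendsto_rpow_atTop hα).comp hlin
  refine summable_of_ratio_norm_eventually_le (r := 1 / 2) (by norm_num) ?_
  filter_upwards [hlin.eventually_gt_atTop 0,
    hpow.eventually_ge_atTop (2 * ((γ + 1) * |x|))] with k hk hkpow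
  simp only [Function.comp_apply] at hkpow
  have hΓ : 0 < Real.Gamma (α * k + β) := Real.Gamma_pos_of_pos (by positivity)
  have hΓ' : 0 < Real.Gamma (α * k + β + α) := Real.Gamma_pos_of_pos (by positivity)
  have hp := poch_pos hγ k
  have hgrow : 2 * ((γ + 1) * |x|) * Real.Gamma (α * k + β) ≤ Real.Gamma (α * k + β + α) :=
    (mul_le_mul_of_nonneg_right hkpow hΓ.le).trans
      (sub_one_rpow_mul_Gamma_le_Gamma_add (by linarith) hα)
  have hcoeff : γ + k ≤ (γ + 1) * (k + 1) := by nlinarith [(Nat.cast_nonneg k : (0 : ℝ) ≤ k)]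
  have hkey : 2 * ((γ + k) * |x|) * Real.Gamma (α * k + β)
      ≤ (k + 1) * Real.Gamma (α * k + β + α) :=
    calc 2 * ((γ + k) * |x|) * Real.Gamma (α * k + β)
        ≤ 2 * ((γ + 1) * (k + 1) * |x|) * Real.Gamma (α * k + β) := by gcongr
      _ = (k + 1) * (2 * ((γ + 1) * |x|) * Real.Gamma (α * k + β)) := by ring
      _ ≤ _ := by gcongr
  have hf : (0 : ℝ) < k.factorial := by positivity
  rw [poch_succ hγ, Nat.factorial_succ, Nat.cast_mul, Nat.cast_succ,
    show α * ((k : ℝ) + 1) + β = α * k + β + α by ring]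
  simp only [norm_div, norm_mul, norm_pow, Real.norm_eq_abs]
  rw [abs_of_pos hp, abs_of_pos hΓ, abs_of_pos hΓ', abs_of_pos hf,
    abs_of_pos (by positivity : 0 < γ + (k : ℝ)), abs_of_pos (by positivity : 0 < (k : ℝ) + 1),
    ← mul_div_assoc, div_le_div_iff₀ (by positivity) (by positivity)]
  have := mul_le_mul_of_nonneg_left hkey
    (by positivity : 0 ≤ poch γ k * |x| ^ k * (k.factorial : ℝ) / 2)
  rw [pow_succ]
  linarith

/-- The first factorial moment series of the Prabhakar-type distribution. -/
lemma hasSum_first_factorial_moment {α β γ : ℝ} (hα : 0 < α) (hβ : 0 < β) (hγ : 0 < γ) (x : ℝ) :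
    HasSum (fun k : ℕ => (k : ℝ) * (poch γ k * x ^ k / (k.factorial * Real.Gamma (α * k + β))))
      (γ * x * prabhakar α (α + β) (γ + 1) x) := by
  rw [← hasSum_nat_add_iff' 1]
  simp only [Finset.sum_range_one, Nat.cast_zero, zero_mul, sub_zero]
  refine ((summable_prabhakar hα (add_pos hα hβ) (add_pos hγ one_pos) x).hasSum.mul_left
    (γ * x)).congr_fun fun k => ?_
  rw [poch_succ_left hγ, Nat.factorial_succ, Nat.cast_mul, Nat.cast_succ,
    show α * ((k : ℝ) + 1) + β = α * k + (α + β) by ring]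
  have hΓ : 0 < Real.Gamma (α * k + (α + β)) := Real.Gamma_pos_of_pos (by positivity)
  field_simp
  ring

/-- The second factorial moment series of the Prabhakar-type distribution. -/
lemma hasSum_second_factorial_moment {α β γ : ℝ} (hα : 0 < α) (hβ : 0 < β) (hγ : 0 < γ) (x : ℝ) :
    HasSum (fun k : ℕ =>
        (k : ℝ) * (k - 1) * (poch γ k * x ^ k / (k.factorial * Real.Gamma (α * k + β))))
      (γ * (γ + 1) * x ^ 2 * prabhakar α (2 * α + β) (γ + 2) x) := by
  have h := (hasSum_first_factorial_moment hα (add_pos hα hβ) (add_pos hγ one_pos) x).mul_left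
    (γ * x)
  rw [← hasSum_nat_add_iff' 1]
  simp only [Finset.sum_range_one, Nat.cast_zero, zero_mul, sub_zero]
  rw [show γ * (γ + 1) * x ^ 2 * prabhakar α (2 * α + β) (γ + 2) x
      = γ * x * ((γ + 1) * x * prabhakar α (α + (α + β)) (γ + 1 + 1) x) by
    rw [show α + (α + β) = 2 * α + β by ring, show γ + 1 + 1 = γ + 2 by ring]; ring]
  refine h.congr_fun fun k => ?_
  rw [poch_succ_left hγ, Nat.factorial_succ, Nat.cast_mul, Nat.cast_succ,
    show α * ((k : ℝ) + 1) + β = α * k + (α + β) by ring]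
  have hΓ : 0 < Real.Gamma (α * k + (α + β)) := Real.Gamma_pos_of_pos (by positivity)
  field_simp
  ring

/-- Unnormalized second moment series:
`∑_{k≥0} k² (γ)_k x^k/(k! Γ(αk+β)) = γ x E_{α,α+β}^{γ+1}(x) + γ(γ+1)x² E_{α,2α+β}^{γ+2}(x)`. -/
theorem prabhakar_second_moment (α β γ : ℝ) (hα : 0 < α) (hβ : 0 < β) (hγ : 0 < γ)
    (x : ℝ) (hx : 0 ≤ x) :
    ∑' k : ℕ, (k : ℝ) ^ 2 * poch γ k * x ^ k / (k.factorial * Real.Gamma (α * k + β))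
      = γ * x * prabhakar α (α + β) (γ + 1) x
        + γ * (γ + 1) * x ^ 2 * prabhakar α (2 * α + β) (γ + 2) x := by
  refine HasSum.tsum_eq (((hasSum_first_factorial_moment hα hβ hγ x).add
    (hasSum_second_factorial_moment hα hβ hγ x)).congr_fun fun k => ?_)
  ring
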